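/- For every integer p ≥ 1, ∑_{t=0}^{p} p^t · s(p+1, t+1) = (p+1)! · C_p, where C_p = C(2p, p)/(p+1) is the p-th Catalan number and s denotes the unsigned Stirling numbers of the first kind. -/

import Mathlib

def stirling : ℕ → ℕ → ℕ
  | 0, 0 => 1
  | 0, _ + 1 => 0
  | _ + 1, 0 => 0
  | n + 1, k + 1 => n * stirling n (k + 1) + stirling n k

theorem stirling_eq_zero_aux : ∀ n k : ℕ, n < k → stirling n k = 0
  | _, 0, h => absurd h (Nat.not_lt_zero _)
  | 0, _ + 1, _ => by rw [stirling]
  | n + 1, k + 1, h => by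
    rw [stirling, stirling_eq_zero_aux n (k + 1) (by omega),
      stirling_eq_zero_aux n k (by omega), mul_zero]

theorem sum_stirling_aux (x n : ℕ) :
    ∑ t ∈ Finset.range (n + 1), x ^ t * stirling (n + 1) (t + 1) = (x + 1).ascFactorial n := by
  induction n with
  | zero => simp [stirling]
  | succ n ih =>
    have h1 : ∀ t, x ^ t * stirling (n + 1 + 1) (t + 1) =
        (n + 1) * (x ^ t * stirling (n + 1) (t + 1)) + x ^ t * stirling (n + 1) t := by
      intro t
      rw [stirling]
      ring
    have h2 : ∀ t, x ^ (t + 1) * stirling (n + 1) (t + 1) =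
        x * (x ^ t * stirling (n + 1) (t + 1)) := by
      intro t
      ring
    have h0 : stirling (n + 1) 0 = 0 := by rw [stirling]
    rw [Finset.sum_congr rfl (fun t _ => h1 t), Finset.sum_add_distrib, ← Finset.mul_sum,
      Finset.sum_range_succ, ih, stirling_eq_zero_aux (n + 1) (n + 1 + 1) (by omega),
      Finset.sum_range_succ', Finset.sum_congr rfl (fun t _ => h2 t), ← Finset.mul_sum, ih,
      h0, Nat.ascFactorial_succ]
    ring

theorem stmt_13 (p : ℕ) (hp : 1 ≤ p) :
    ∑ t ∈ Finset.range (p + 1), p ^ t * stirling (p + 1) (t + 1) =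
      Nat.factorial (p + 1) * catalan p := by
  have h := succ_mul_catalan_eq_centralBinom p
  rw [Nat.centralBinom] at h
  rw [sum_stirling_aux, Nat.ascFactorial_eq_factorial_mul_choose, ← two_mul, ← h,
    Nat.factorial_succ]
  ring
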